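/- arXiv:2411.10889 — 2 statements merged into one kernel-verified Lean document; each statement's English description precedes it below -/
import Mathlib

section
/- Let n ≥ 1, let D be a symmetric real n×n matrix with zero diagonal, and suppose U is an orthogonal n×n matrix and λ : Fin n → ℝ satisfy −(1/2)·C·D·C = U·diag(λ)·Uᵀ. Let W ⊆ Fin n with |W| = k, and let λ̃ : Fin n → ℝ satisfy λ̃_i = 0 for all i ∉ W. Set Δλ := λ − λ̃, B̃ := U·diag(λ̃)·Uᵀ, and define D̃ by D̃_{ij} := B̃_{ii} + B̃_{jj} − 2·B̃_{ij}. Assume B̃·𝟙 = 0, where 𝟙 is the all-ones vector. Then ‖D̃ − D‖_F² = C̃₁ + C̃₂ + C̃₃, where C̃₁ = 4·[Σ_{i∉W} λ_i² + Σ_{i∈W} (Δλ_i)²], C̃₂ = 4·[Σ_{i∉W} λ_i + Σ_{i∈W} Δλ_i]², and C̃₃ = 2n·‖(U⊙U)·Δλ‖² − C̃₂/2. -/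
open Matrix BigOperators

/-- The all-ones matrix. -/
def Jmat (n : ℕ) : Matrix (Fin n) (Fin n) ℝ := Matrix.of fun _ _ => (1 : ℝ)

/-- The centering matrix `C = I - (1/n) J`. -/
noncomputable def Cmat (n : ℕ) : Matrix (Fin n) (Fin n) ℝ :=
  (1 : Matrix (Fin n) (Fin n) ℝ) - ((1 : ℝ) / n) • Jmat n

theorem Cmat_mul_apply {n : ℕ} (M : Matrix (Fin n) (Fin n) ℝ) (i j : Fin n) :
    (Cmat n * M) i j = M i j - (1 / n : ℝ) * ∑ k, M k j := by
  rw [Cmat, Matrix.sub_mul, Matrix.one_mul, Matrix.smul_mul]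
  simp [Jmat, Matrix.mul_apply]

theorem mul_Cmat_apply {n : ℕ} (M : Matrix (Fin n) (Fin n) ℝ) (i j : Fin n) :
    (M * Cmat n) i j = M i j - (1 / n : ℝ) * ∑ k, M i k := by
  rw [Cmat, Matrix.mul_sub, Matrix.mul_one, Matrix.mul_smul]
  simp [Jmat, Matrix.mul_apply]

theorem Cmat_mulVec_one {n : ℕ} (hn : 1 ≤ n) : Cmat n *ᵥ (fun _ => (1 : ℝ)) = 0 := by
  have hn_ne : (n : ℝ) ≠ 0 := by positivity
  ext i
  simp [Cmat, Jmat, Matrix.mulVec, dotProduct, Matrix.one_apply, hn_ne]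

/-- Double centering is inverted by the passage from a Gram matrix to squared distances. -/
theorem hollow_eq_of_doubleCentering {n : ℕ} {D B : Matrix (Fin n) (Fin n) ℝ}
    (hsymm : D.IsSymm) (hhollow : ∀ i, D i i = 0)
    (hB : (-(1 / 2) : ℝ) • (Cmat n * D * Cmat n) = B) (i j : Fin n) :
    D i j = B i i + B j j - 2 * B i j := by
  have hcol : ∀ j, ∑ k, D k j = ∑ k, D j k := fun j =>
    Finset.sum_congr rfl fun k _ => hsymm.apply j k
  subst hB
  simp only [Matrix.smul_apply, smul_eq_mul, mul_Cmat_apply, Cmat_mul_apply, hhollow, hcol,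
    Finset.sum_sub_distrib]
  ring

/-- The sum of squared distances of a matrix with vanishing row sums. -/
theorem sum_sq_distances_of_row_sums_zero {n : ℕ} {E : Matrix (Fin n) (Fin n) ℝ}
    (hE : ∀ i, ∑ j, E i j = 0) (hsymm : E.IsSymm) :
    ∑ i, ∑ j, (E i i + E j j - 2 * E i j) ^ 2 =
      4 * ∑ i, ∑ j, E i j ^ 2 + 2 * E.trace ^ 2 + 2 * n * ∑ i, E i i ^ 2 := by
  have hexpand : ∀ i j, (E i i + E j j - 2 * E i j) ^ 2 =
      4 * E i j ^ 2 + 2 * (E i i * E j j) + E i i ^ 2 + E j j ^ 2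
        - 4 * (E i i * E i j) - 4 * (E j j * E i j) := fun i j => by ring
  have hrow : ∑ i, ∑ j, E i i * E i j = 0 := by simp [← Finset.mul_sum, hE]
  have hcol : ∑ i, ∑ j, E j j * E i j = 0 := by
    rw [Finset.sum_comm, ← hrow]
    exact Finset.sum_congr rfl fun i _ => Finset.sum_congr rfl fun j _ => by rw [hsymm.apply i j]
  have htrace : ∑ i, ∑ j, E i i * E j j = E.trace ^ 2 := by
    rw [sq, Matrix.trace, Finset.sum_mul_sum]; rfl
  simp only [hexpand, Finset.sum_sub_distrib, Finset.sum_add_distrib, ← Finset.mul_sum] at *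
  simp only [Finset.sum_const, Finset.card_univ, Fintype.card_fin, nsmul_eq_mul,
    ← Finset.mul_sum] at *
  rw [hrow, hcol, htrace]
  ring

section OrthogonalConjugation

variable {n : ℕ} {U : Matrix (Fin n) (Fin n) ℝ}

theorem conj_diagonal_isSymm (d : Fin n → ℝ) : (U * Matrix.diagonal d * Uᵀ).IsSymm := by
  simp [Matrix.IsSymm, Matrix.transpose_mul, Matrix.mul_assoc]

theorem conj_diagonal_apply_self (d : Fin n → ℝ) (i : Fin n) :
    (U * Matrix.diagonal d * Uᵀ) i i = ∑ j, (U i j * U i j) * d j := by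
  rw [Matrix.mul_apply]
  refine Finset.sum_congr rfl fun j _ => ?_
  rw [Matrix.mul_diagonal, Matrix.transpose_apply]
  ring

theorem trace_conj_diagonal (hU : U * Uᵀ = 1) (d : Fin n → ℝ) :
    (U * Matrix.diagonal d * Uᵀ).trace = ∑ i, d i := by
  rw [Matrix.trace_mul_comm, ← Matrix.mul_assoc, mul_eq_one_comm.mp hU, Matrix.one_mul,
    Matrix.trace_diagonal]

theorem sum_sq_conj_diagonal (hU : U * Uᵀ = 1) (d : Fin n → ℝ) :
    ∑ i, ∑ j, (U * Matrix.diagonal d * Uᵀ) i j ^ 2 = ∑ i, d i ^ 2 := by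
  have hsq : (U * Matrix.diagonal d * Uᵀ) * (U * Matrix.diagonal d * Uᵀ) =
      U * Matrix.diagonal (fun i => d i ^ 2) * Uᵀ := by
    calc _ = U * Matrix.diagonal d * (Uᵀ * U) * Matrix.diagonal d * Uᵀ := by
          simp only [Matrix.mul_assoc]
      _ = _ := by
          rw [mul_eq_one_comm.mp hU, Matrix.mul_one, Matrix.mul_assoc U,
            Matrix.diagonal_mul_diagonal]
          simp only [sq]
  rw [← trace_conj_diagonal hU (fun i => d i ^ 2), ← hsq, Matrix.trace]
  refine Finset.sum_congr rfl fun i _ => ?_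
  rw [Matrix.diag_apply, Matrix.mul_apply]
  refine Finset.sum_congr rfl fun j _ => ?_
  rw [(conj_diagonal_isSymm d).apply i j, sq]

end OrthogonalConjugation

theorem generalized_stress_decomposition (n : ℕ) (hn : 1 ≤ n)
    (D : Matrix (Fin n) (Fin n) ℝ)
    (hsymm : D.IsSymm) (hhollow : ∀ i, D i i = 0)
    (U : Matrix (Fin n) (Fin n) ℝ) (hU : U * Uᵀ = 1) (l : Fin n → ℝ)
    (hdecomp : (-(1 / 2) : ℝ) • (Cmat n * D * Cmat n) = U * Matrix.diagonal l * Uᵀ)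
    (W : Finset (Fin n)) (k : ℕ) (hk : W.card = k)
    (lt : Fin n → ℝ) (hsupp : ∀ i ∉ W, lt i = 0)
    (hcenter : (U * Matrix.diagonal lt * Uᵀ) *ᵥ (fun _ => (1 : ℝ)) = 0) :
    let dl : Fin n → ℝ := fun i => l i - lt i
    let Bt : Matrix (Fin n) (Fin n) ℝ := U * Matrix.diagonal lt * Uᵀ
    let Dt : Matrix (Fin n) (Fin n) ℝ :=
      Matrix.of fun i j => Bt i i + Bt j j - 2 * Bt i j
    let C1 : ℝ := 4 * (∑ i ∈ Wᶜ, (l i) ^ 2 + ∑ i ∈ W, (dl i) ^ 2)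
    let C2 : ℝ := 4 * (∑ i ∈ Wᶜ, l i + ∑ i ∈ W, dl i) ^ 2
    let C3 : ℝ := 2 * n * (∑ i, (∑ j, (U i j * U i j) * dl j) ^ 2) - C2 / 2
    ∑ i, ∑ j, (Dt i j - D i j) ^ 2 = C1 + C2 + C3 := by
  intro dl Bt Dt C1 C2 C3
  set E : Matrix (Fin n) (Fin n) ℝ := U * Matrix.diagonal dl * Uᵀ with hEdef
  have hE : E = U * Matrix.diagonal l * Uᵀ - Bt := by
    rw [hEdef, ← Matrix.sub_mul, ← Matrix.mul_sub, Matrix.diagonal_sub]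
  have hrow : ∀ i, ∑ j, E i j = 0 := by
    have hmulVec : E *ᵥ (fun _ => (1 : ℝ)) = 0 := by
      rw [hE, Matrix.sub_mulVec, hcenter, ← hdecomp, Matrix.smul_mulVec,
        ← Matrix.mulVec_mulVec, Cmat_mulVec_one hn]
      simp
    intro i
    simpa [Matrix.mulVec, dotProduct] using congrFun hmulVec i
  have hstress : ∀ i j, (Dt i j - D i j) ^ 2 = (E i i + E j j - 2 * E i j) ^ 2 := by
    intro i j
    rw [hollow_eq_of_doubleCentering hsymm hhollow hdecomp i j, hE]
    simp only [Dt, Matrix.of_apply, Matrix.sub_apply]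
    ring
  have hdl : ∀ i ∈ Wᶜ, dl i = l i := fun i hi => by
    simp [dl, hsupp i (Finset.mem_compl.mp hi)]
  have hC1 : C1 = 4 * ∑ i, dl i ^ 2 := by
    rw [← Finset.sum_compl_add_sum W, Finset.sum_congr rfl fun i hi => by rw [hdl i hi]]
  have hC2 : C2 = 4 * (∑ i, dl i) ^ 2 := by
    rw [← Finset.sum_compl_add_sum W, Finset.sum_congr rfl hdl]
  simp only [hstress]
  rw [sum_sq_distances_of_row_sums_zero hrow (conj_diagonal_isSymm dl),
    sum_sq_conj_diagonal hU, trace_conj_diagonal hU, hC1]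
  simp only [C3, hC2, hEdef, conj_diagonal_apply_self]
  ring
end

section
/- Let n ∈ ℕ, k ≤ n, and let λ : Fin n → ℝ with λ_i ≠ 0 for all i. Define F_k(S) := Σ_{i ∉ S} (λ i)² + (1/(k+1))·(Σ_{i ∉ S} λ i)². Then there exists a subset S ⊆ Fin n with |S| = k such that F_k(S) ≤ F_k(T) for every subset T ⊆ Fin n with |T| = k, and S consists of the largest positive values and the smallest negative values: for all i ∈ S and j ∉ S, if λ_i > 0 and λ_j > 0 then λ_j ≤ λ_i, and if λ_i < 0 and λ_j < 0 then λ_i ≤ λ_j. -/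
open BigOperators

/-- `H(S)` is the sum of the values not selected. -/
noncomputable def Hsum {n : ℕ} (l : Fin n → ℝ) (S : Finset (Fin n)) : ℝ :=
  ∑ i ∈ Sᶜ, l i

/-- `F_k(S) = Σ_{i∉S} λ_i² + (1/(k+1))·(H(S))²`. -/
noncomputable def Fk {n : ℕ} (l : Fin n → ℝ) (k : ℕ) (S : Finset (Fin n)) : ℝ :=
  ∑ i ∈ Sᶜ, (l i) ^ 2 + (1 / ((k : ℝ) + 1)) * (Hsum l S) ^ 2

theorem sum_compl_insert_erase {α M : Type*} [Fintype α] [DecidableEq α] [AddCommGroup M]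
    (f : α → M) {S : Finset α} {i j : α} (hi : i ∈ S) (hj : j ∉ S) :
    ∑ m ∈ (insert j (S.erase i))ᶜ, f m = ∑ m ∈ Sᶜ, f m - f j + f i := by
  have hcompl : (insert j (S.erase i))ᶜ = insert i (Sᶜ.erase j) := by
    ext m
    simp only [Finset.mem_compl, Finset.mem_insert, Finset.mem_erase]
    grind
  rw [hcompl, Finset.sum_insert (by simp [hi]), Finset.sum_erase_eq_sub (by simpa using hj),
    add_comm]

theorem Fk_neg {n : ℕ} (l : Fin n → ℝ) (k : ℕ) (S : Finset (Fin n)) :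
    Fk (fun m => -l m) k S = Fk l k S := by
  simp [Fk, Hsum]

/-- The first-order optimality condition obtained by exchanging `i ∈ S` with `j ∉ S`. -/
theorem exchange_nonneg_of_optimal {n k : ℕ} {l : Fin n → ℝ} {S : Finset (Fin n)}
    (hcard : S.card = k) (hopt : ∀ T : Finset (Fin n), T.card = k → Fk l k S ≤ Fk l k T)
    {i j : Fin n} (hi : i ∈ S) (hj : j ∉ S) :
    0 ≤ (l i - l j) * (((k : ℝ) + 1) * (l i + l j) + 2 * Hsum l S + l i - l j) := by
  have hswap : (insert j (S.erase i)).card = k := by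
    rw [Finset.card_insert_of_notMem (fun h => hj (Finset.mem_of_mem_erase h)),
      Finset.card_erase_add_one hi, hcard]
  have hle := hopt _ hswap
  have hH : Hsum l (insert j (S.erase i)) = Hsum l S - l j + l i :=
    sum_compl_insert_erase l hi hj
  rw [Fk, Fk, hH, sum_compl_insert_erase (fun m => l m ^ 2) hi hj] at hle
  have hk : (0 : ℝ) < (k : ℝ) + 1 := by positivity
  have hmul := mul_nonneg hk.le (sub_nonneg.2 hle)
  refine hmul.trans_eq ?_
  field_simp
  ring

/-- In an optimal selection no unselected value exceeds a selected positive one. -/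
theorem le_of_optimal_of_pos {n k : ℕ} {l : Fin n → ℝ} {S : Finset (Fin n)}
    (hcard : S.card = k) (hopt : ∀ T : Finset (Fin n), T.card = k → Fk l k S ≤ Fk l k T)
    {i j : Fin n} (hi : i ∈ S) (hj : j ∉ S) (hpos : 0 < l i) : l j ≤ l i := by
  by_contra! hlt
  have hk : (1 : ℝ) ≤ k := by
    exact_mod_cast hcard ▸ Finset.card_pos.2 ⟨i, hi⟩
  have hj_exch := nonpos_of_mul_nonneg_right
    (exchange_nonneg_of_optimal hcard hopt hi hj) (sub_neg.2 hlt)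
  have hH : Hsum l S < 0 := by nlinarith
  obtain ⟨m, hm, hm0⟩ : ∃ m ∈ Sᶜ, l m < 0 := by
    by_contra! h
    exact hH.not_ge (Finset.sum_nonneg h)
  have hm_exch := nonneg_of_mul_nonneg_right
    (exchange_nonneg_of_optimal hcard hopt hi (Finset.mem_compl.1 hm))
    (by linarith : 0 < l i - l m)
  have hm_neg : (k : ℝ) * l m < 0 := by nlinarith
  have hj_pos : (0 : ℝ) < k * l j := by nlinarith
  nlinarith

theorem exists_optimal_selection_plus (n k : ℕ) (hk : k ≤ n)
    (l : Fin n → ℝ) (hl : ∀ i, l i ≠ 0) :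
    ∃ S : Finset (Fin n), S.card = k ∧
      (∀ T : Finset (Fin n), T.card = k → Fk l k S ≤ Fk l k T) ∧
      (∀ i ∈ S, ∀ j ∉ S,
        (0 < l i → 0 < l j → l j ≤ l i) ∧ (l i < 0 → l j < 0 → l i ≤ l j)) := by
  obtain ⟨S, hS, hmin⟩ := Finset.exists_min_image (Finset.powersetCard k Finset.univ) (Fk l k)
    (Finset.powersetCard_nonempty.2 (by simpa using hk))
  have hcard : S.card = k := (Finset.mem_powersetCard.1 hS).2
  have hopt : ∀ T : Finset (Fin n), T.card = k → Fk l k S ≤ Fk l k T := fun T hT =>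
    hmin T (Finset.mem_powersetCard.2 ⟨Finset.subset_univ T, hT⟩)
  refine ⟨S, hcard, hopt, fun i hi j hj => ⟨fun hi0 _ => ?_, fun hi0 _ => ?_⟩⟩
  · exact le_of_optimal_of_pos hcard hopt hi hj hi0
  · refine neg_le_neg_iff.1 (le_of_optimal_of_pos (l := fun m => -l m) hcard (fun T hT => ?_)
      hi hj (neg_pos.2 hi0))
    simpa only [Fk_neg] using hopt T hT
end
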